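/- Let ℓ ∈ ℕ and let K be the Legendre covariance kernel of degree ℓ. Then for every θ ∈ (0, π) and every φ ∈ ℝ, evaluating at the diagonal point θ₁ = θ₂ = θ, φ₁ = φ₂ = φ one has: (i) (1/sin²θ) · ∂³K/∂φ₁²∂θ₂ = − cot θ · P_ℓ'(1); (ii) (1/sin³θ) · ∂³K/∂φ₁²∂φ₂ = 0. -/

import Mathlib

open Real MeasureTheory

/-- The `l`-th Legendre polynomial, via Rodrigues' formula. -/
noncomputable def legendre (l : ℕ) : ℝ → ℝ :=
  fun t => (1 / (2 ^ l * (Nat.factorial l : ℝ))) * iteratedDeriv l (fun s => (s ^ 2 - 1) ^ l) t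

/-- The Legendre covariance kernel of degree `l`. -/
noncomputable def legendreKernel (l : ℕ) (θ₁ φ₁ θ₂ φ₂ : ℝ) : ℝ :=
  legendre l (Real.cos θ₁ * Real.cos θ₂ + Real.sin θ₁ * Real.sin θ₂ * Real.cos (φ₁ - φ₂))

theorem contDiff_legendre (l : ℕ) (n : ℕ) : ContDiff ℝ n (legendre l) := by
  have h : ContDiff ℝ ((n + l : ℕ) : WithTop ℕ∞) (fun s : ℝ => (s ^ 2 - 1) ^ l) := by fun_prop
  have h' : ContDiff ℝ n (iteratedDeriv l (fun s : ℝ => (s ^ 2 - 1) ^ l)) :=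
    by simpa only [iteratedDeriv_eq_iterate] using h.iterate_deriv' n l
  exact contDiff_const.mul h'

theorem iteratedDeriv_two_comp_add_mul_cos {f : ℝ → ℝ} (hf : ContDiff ℝ 2 f) (a b c x : ℝ) :
    iteratedDeriv 2 (fun y => f (a + b * cos (y - c))) x =
      deriv (deriv f) (a + b * cos (x - c)) * (b * sin (x - c)) ^ 2
        - deriv f (a + b * cos (x - c)) * (b * cos (x - c)) := by
  have hf' : ContDiff ℝ 1 (deriv f) := ContDiff.deriv' (n := 1) (by simpa [one_add_one_eq_two] using hf)
  have harg (y : ℝ) : HasDerivAt (fun y => a + b * cos (y - c)) (-(b * sin (y - c))) y := by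
    simpa using ((((hasDerivAt_id y).sub_const c).cos).const_mul b).const_add a
  have hsin (y : ℝ) : HasDerivAt (fun y => -(b * sin (y - c))) (-(b * cos (y - c))) y := by
    simpa using ((((hasDerivAt_id y).sub_const c).sin).const_mul b).fun_neg
  have hfirst : deriv (fun y => f (a + b * cos (y - c))) =
      fun y => deriv f (a + b * cos (y - c)) * -(b * sin (y - c)) := by
    funext y
    exact ((hf.differentiable (by norm_num) _).hasDerivAt.comp y (harg y)).deriv
  have hsecond := ((hf'.differentiable (by norm_num) _).hasDerivAt.comp x (harg x)).mul (hsin x)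
  rw [iteratedDeriv_succ, iteratedDeriv_one, hfirst]
  refine hsecond.deriv.trans ?_
  simp only [Function.comp_apply]
  ring

theorem deriv_eq_zero_of_even_about {g : ℝ → ℝ} {c : ℝ} (hg : ∀ x, g (2 * c - x) = g x) :
    deriv g c = 0 := by
  have h := deriv_comp_const_sub g (2 * c) c
  rw [funext hg, show 2 * c - c = c by ring] at h
  linarith

theorem stmt3 (l : ℕ) (θ φ : ℝ) (hθ : θ ∈ Set.Ioo 0 Real.pi) :
    (1 / Real.sin θ ^ 2) *
      deriv (fun θ₂ => iteratedDeriv 2 (fun φ₁ => legendreKernel l θ φ₁ θ₂ φ) φ) θ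
      = -(Real.cos θ / Real.sin θ) * deriv (legendre l) 1 ∧
    (1 / Real.sin θ ^ 3) *
      deriv (fun φ₂ => iteratedDeriv 2 (fun φ₁ => legendreKernel l θ φ₁ θ φ₂) φ) φ = 0 := by
  have hsin : sin θ ≠ 0 := (sin_pos_of_mem_Ioo hθ).ne'
  have hP : ContDiff ℝ 2 (legendre l) := contDiff_legendre l 2
  have hP' : ContDiff ℝ 1 (deriv (legendre l)) := ContDiff.deriv' (n := 1) (by simpa [one_add_one_eq_two] using hP)
  simp only [legendreKernel, iteratedDeriv_two_comp_add_mul_cos hP]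
  constructor
  · have hdist : HasDerivAt (fun t => cos (θ - t)) 0 θ := by
      simpa using ((hasDerivAt_id θ).const_sub θ).cos
    have hprod := ((hP'.differentiable (by norm_num) _).hasDerivAt.comp θ hdist).mul
      ((hasDerivAt_sin θ).const_mul (sin θ))
    have heq : (fun t => deriv (deriv (legendre l))
          (cos θ * cos t + sin θ * sin t * cos (φ - φ)) * (sin θ * sin t * sin (φ - φ)) ^ 2
        - deriv (legendre l) (cos θ * cos t + sin θ * sin t * cos (φ - φ)) *
          (sin θ * sin t * cos (φ - φ))) =
        -((deriv (legendre l) ∘ fun t => cos (θ - t)) * fun t => sin θ * sin t) := by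
      funext t
      simp [cos_sub]
    rw [heq, hprod.neg.deriv]
    simp only [Function.comp_apply, sub_self, cos_zero]
    field_simp
    ring
  · rw [deriv_eq_zero_of_even_about, mul_zero]
    intro x
    rw [show φ - (2 * φ - x) = -(φ - x) by ring, cos_neg, sin_neg]
    ring
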